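/- arXiv:0905.3450 — 6 statements merged into one kernel-verified Lean document; each statement's English description precedes it below -/
import Mathlib

section
/- Let μ be a probability measure on (0,∞) and let u_0(s) = ∫_{(0,∞)} e^{−sx} μ(dx) for Re(s) ≥ 0. Define u(τ, s) = e^{−τ} u_0(e^{−τ}s) / (1 − u_0(e^{−τ}s)(1 − e^{−τ})) for τ ≥ 0 and Re(s) > 0. Then the denominator never vanishes for Re(s) > 0 and τ ≥ 0, and u satisfies the partial differential equation ∂_τ u + s ∂_s u = −u(1 − u) at every point (τ, s) with τ > 0 and Re(s) > 0. -/
open MeasureTheory Set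

/-- Solution by characteristics for the constant kernel `K = 2`: if `u₀` is the
Laplace transform of a probability measure on `(0,∞)` and
`u(τ,s) = e^{-τ} u₀(e^{-τ}s) / (1 - u₀(e^{-τ}s)(1 - e^{-τ}))`, then the denominator
never vanishes for `Re s > 0`, `τ ≥ 0`, and `u` satisfies
`∂_τ u + s ∂_s u = -u(1-u)` at every point with `τ > 0` and `Re s > 0`. -/
theorem constant_kernel_characteristics
    (μ : Measure ℝ) [IsProbabilityMeasure μ] (hsupp : μ (Iic 0) = 0)
    (u0 : ℂ → ℂ) (hu0 : ∀ s : ℂ, u0 s = ∫ x, Complex.exp (-(s * x)) ∂μ)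
    (u : ℝ → ℂ → ℂ)
    (hu : ∀ (τ : ℝ) (s : ℂ),
      u τ s = (Real.exp (-τ) : ℂ) * u0 ((Real.exp (-τ) : ℂ) * s) /
        (1 - u0 ((Real.exp (-τ) : ℂ) * s) * (1 - (Real.exp (-τ) : ℂ)))) :
    (∀ τ ≥ (0 : ℝ), ∀ s : ℂ, 0 < s.re →
        1 - u0 ((Real.exp (-τ) : ℂ) * s) * (1 - (Real.exp (-τ) : ℂ)) ≠ 0) ∧
    (∀ τ : ℝ, 0 < τ → ∀ s : ℂ, 0 < s.re →
      ∃ uτ us : ℂ,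
        HasDerivAt (fun τ' : ℝ => u τ' s) uτ τ ∧
        HasDerivAt (fun s' : ℂ => u τ s') us s ∧
        uτ + s * us = -(u τ s) * (1 - u τ s)) := by
  have hpos : ∀ᵐ x ∂μ, 0 < x := by
    rw [ae_iff]
    convert hsupp using 2
    ext x
    simp
  have hint : ∀ t : ℝ, 0 ≤ t → Integrable (fun x : ℝ => Real.exp (t * (-x))) μ := by
    intro t ht
    refine Integrable.mono' (integrable_const (1 : ℝ)) (by fun_prop) ?_
    filter_upwards [hpos] with x hx
    rw [Real.norm_eq_abs, abs_of_pos (Real.exp_pos _), Real.exp_le_one_iff]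
    nlinarith [mul_nonneg ht hx.le]
  have hmgf : u0 = ProbabilityTheory.complexMGF (fun x : ℝ => -x) μ := by
    funext s
    rw [hu0, ProbabilityTheory.complexMGF]
    refine integral_congr_ae (Filter.Eventually.of_forall fun x => ?_)
    simp
  have hdiff : ∀ z : ℂ, 0 < z.re → DifferentiableAt ℂ u0 z := by
    intro z hz
    rw [hmgf]
    refine (ProbabilityTheory.hasDerivAt_complexMGF ?_).differentiableAt
    rw [mem_interior_iff_mem_nhds]
    filter_upwards [Ioi_mem_nhds hz] with t ht
    exact hint t (le_of_lt ht)
  have hbound : ∀ z : ℂ, 0 < z.re → ‖u0 z‖ ≤ 1 := by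
    intro z hz
    rw [hu0]
    have h := norm_integral_le_of_norm_le_const (μ := μ) (C := 1)
      (f := fun x : ℝ => Complex.exp (-(z * x))) ?_
    · simpa using h
    · filter_upwards [hpos] with x hx
      rw [Complex.norm_exp, Real.exp_le_one_iff]
      simp
      positivity
  have hre : ∀ (τ : ℝ) (s : ℂ), 0 < s.re → 0 < ((Real.exp (-τ) : ℂ) * s).re := by
    intro τ s hs
    rw [Complex.re_ofReal_mul]
    positivity
  have hD : ∀ τ ≥ (0 : ℝ), ∀ s : ℂ, 0 < s.re →
      1 - u0 ((Real.exp (-τ) : ℂ) * s) * (1 - (Real.exp (-τ) : ℂ)) ≠ 0 := by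
    intro τ hτ s hs h0
    have h1 := hbound _ (hre τ s hs)
    have h2 : ‖(1 - (Real.exp (-τ) : ℂ))‖ < 1 := by
      rw [← Complex.ofReal_one, ← Complex.ofReal_sub, Complex.norm_real, Real.norm_eq_abs, abs_lt]
      have h3 := Real.exp_pos (-τ)
      have h4 : Real.exp (-τ) ≤ 1 := Real.exp_le_one_iff.2 (by linarith)
      constructor <;> linarith
    have h5 := congrArg norm (sub_eq_zero.1 h0)
    rw [norm_one, norm_mul] at h5
    nlinarith [norm_nonneg (1 - (Real.exp (-τ) : ℂ))]
  refine ⟨hD, ?_⟩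
  intro τ hτ s hs
  have hDs := hD τ hτ.le s hs
  have hd := (hdiff _ (hre τ s hs)).hasDerivAt
  have hA : HasDerivAt (fun τ' : ℝ => (Real.exp (-τ') : ℂ)) (-(Real.exp (-τ) : ℂ)) τ := by
    have h := ((hasDerivAt_neg τ).exp).ofReal_comp
    simpa using h
  have hW : HasDerivAt (fun τ' : ℝ => u0 ((Real.exp (-τ') : ℂ) * s)) _ τ :=
    HasDerivAt.comp τ hd (hA.mul_const s)
  have hS : HasDerivAt (fun s' : ℂ => u0 ((Real.exp (-τ) : ℂ) * s')) _ s :=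
    HasDerivAt.comp s hd ((hasDerivAt_id s).const_mul (Real.exp (-τ) : ℂ))
  have e1 := (hA.mul hW).div ((hW.mul (hA.const_sub 1)).const_sub 1) hDs
  have e2 := (hS.const_mul (Real.exp (-τ) : ℂ)).div
    ((hS.mul_const (1 - (Real.exp (-τ) : ℂ))).const_sub 1) hDs
  refine ⟨_, _, e1.congr_of_eventuallyEq (Filter.Eventually.of_forall fun τ' => hu τ' s),
    e2.congr_of_eventuallyEq (Filter.Eventually.of_forall fun s' => hu τ s'), ?_⟩
  rw [hu]
  simp only [Pi.mul_apply, mul_one]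
  generalize deriv u0 _ = d
  generalize u0 _ = w at hDs ⊢
  generalize (Real.exp (-τ) : ℂ) = a at hDs ⊢
  field_simp
  ring
end

section
/- For τ ≥ 0 define F(τ, x̂) = 1 − (1 − e^{−τ})^{⌈e^{τ} x̂⌉ − 1} for x̂ > 0, where ⌈y⌉ = min{j ∈ ℕ : j ≥ y}, and let F_*(x̂) = 1 − e^{−x̂}. Then there exists a constant C such that for all τ ≥ 0, sup_{x̂>0} |F(τ, x̂) − F_*(x̂)| ≤ C e^{−τ}. -/
/-- The exponential convergence rate is attained for monodisperse initial data with
constant kernel `K = 2`: with `F(τ,xh) = 1 - (1 - e^{-τ})^{⌈e^τ xh⌉ - 1}` and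
`F_*(xh) = 1 - e^{-xh}`, there is a constant `C` such that
`sup_{xh>0} |F(τ,xh) - F_*(xh)| ≤ C e^{-τ}` for all `τ ≥ 0`. -/
theorem monodisperse_constant_kernel_rate :
    ∃ C : ℝ, ∀ τ ≥ (0 : ℝ), ∀ xh > (0 : ℝ),
      |(1 - (1 - Real.exp (-τ)) ^ (⌈Real.exp τ * xh⌉₊ - 1))
          - (1 - Real.exp (-xh))| ≤ C * Real.exp (-τ) := by
  refine ⟨1, fun τ hτ x hx => ?_⟩
  have hq0 : 0 < Real.exp (-τ) := Real.exp_pos _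
  have hq1 : Real.exp (-τ) ≤ 1 := Real.exp_le_one_iff.mpr (by linarith)
  have hqt : Real.exp (-τ) * Real.exp τ = 1 := by rw [← Real.exp_add]; simp
  have hy : 0 < Real.exp τ * x := by positivity
  have hc : 0 < ⌈Real.exp τ * x⌉₊ := Nat.ceil_pos.mpr hy
  obtain ⟨n, hn⟩ : ∃ n, ⌈Real.exp τ * x⌉₊ = n + 1 := ⟨_, (Nat.succ_pred_eq_of_pos hc).symm⟩
  have h1 := Nat.le_ceil (Real.exp τ * x)
  have h2 := Nat.ceil_lt_add_one hy.le
  rw [hn] at h1 h2 ⊢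
  push_cast at h1 h2
  rw [Nat.add_sub_cancel]
  generalize Real.exp (-τ) = q at *
  have hx' : q * (Real.exp τ * x) = x := by rw [← mul_assoc, hqt, one_mul]
  have h1' : x ≤ n * q + q := by nlinarith [mul_le_mul_of_nonneg_left h1 hq0.le]
  have h2' : n * q ≤ x := by nlinarith [mul_lt_mul_of_pos_left h2 hq0]
  have hpow : Real.exp (-q) ^ n = Real.exp (-(n * q)) := by
    rw [← Real.exp_nat_mul]; ring_nf
  have hA : (1 - q) ^ n ≤ Real.exp (-(n * q)) := by
    rw [← hpow]
    exact pow_le_pow_left₀ (by linarith) (Real.one_sub_le_exp_neg q) n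
  have hE1 : Real.exp (-(n * q)) ≤ 1 := Real.exp_le_one_iff.mpr (by
    have : (0 : ℝ) ≤ n * q := by positivity
    linarith)
  have hE0 : 0 < Real.exp (-(n * q)) := Real.exp_pos _
  have hB : Real.exp (-(n * q)) - Real.exp (-x) ≤ q := by
    have e1 : Real.exp (-x) = Real.exp (-(n * q)) * Real.exp (-(x - n * q)) := by
      rw [← Real.exp_add]; ring_nf
    have e2 := Real.one_sub_le_exp_neg (x - n * q)
    rw [e1]
    nlinarith [mul_le_mul_of_nonneg_left e2 hE0.le]
  have hC : Real.exp (-x) ≤ Real.exp (-(n * q)) := Real.exp_le_exp.mpr (by linarith)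
  have hD : Real.exp (-(n * q)) - (1 - q) ^ n ≤ q := by
    have b1 : 1 + (n : ℝ) * (-(q ^ 2)) ≤ (1 + -(q ^ 2)) ^ n :=
      one_add_mul_le_pow (by nlinarith) n
    have b2 : 1 + -(q ^ 2) ≤ (1 - q) * Real.exp q := by
      nlinarith [mul_le_mul_of_nonneg_left (Real.add_one_le_exp q) (sub_nonneg.mpr hq1)]
    have b3 : (1 + -(q ^ 2)) ^ n ≤ ((1 - q) * Real.exp q) ^ n :=
      pow_le_pow_left₀ (by nlinarith) b2 n
    have b4 : Real.exp (-(n * q)) * ((1 - q) * Real.exp q) ^ n = (1 - q) ^ n := by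
      rw [← hpow, ← mul_pow, mul_left_comm, ← Real.exp_add]; simp
    have b5 := mul_le_mul_of_nonneg_left (b1.trans b3) hE0.le
    rw [b4] at b5
    have b6 : (n * q) * Real.exp (-(n * q)) ≤ 1 := by
      have := Real.add_one_le_exp (n * q)
      have e : Real.exp (n * q) * Real.exp (-(n * q)) = 1 := by rw [← Real.exp_add]; simp
      nlinarith
    nlinarith [mul_le_mul_of_nonneg_left b6 hq0.le]
  rw [abs_le]
  constructor <;> linarith
end

section
/- There exists a constant C such that for all τ ≥ 1 and all x̂ > 0, the quantity α(τ, x̂) = x̂ + (⌈e^{τ} x̂⌉ − 1) log(1 − e^{−τ}) satisfies |α(τ, x̂)| ≤ C(1 + x̂/2) e^{−τ}. -/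
/-- Estimate for the exponent `α(τ,xh) = xh + (⌈e^τ xh⌉ - 1) log(1 - e^{-τ})` appearing
in the monodisperse solution for the constant kernel: there is a constant `C` such that
`|α(τ,xh)| ≤ C (1 + xh/2) e^{-τ}` for all `τ ≥ 1` and `xh > 0`. -/
theorem monodisperse_exponent_estimate :
    ∃ C : ℝ, ∀ τ ≥ (1 : ℝ), ∀ xh > (0 : ℝ),
      |xh + ((⌈Real.exp τ * xh⌉₊ : ℝ) - 1) * Real.log (1 - Real.exp (-τ))| ≤
        C * (1 + xh / 2) * Real.exp (-τ) := by
  refine ⟨4, fun τ hτ x hx => ?_⟩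
  have hE : 2 ≤ Real.exp τ := by linarith [Real.add_one_le_exp τ]
  have hEe : Real.exp τ * Real.exp (-τ) = 1 := by rw [← Real.exp_add]; simp
  have he0 : 0 < Real.exp (-τ) := Real.exp_pos _
  have hn1 := Nat.le_ceil (Real.exp τ * x)
  have hn2 := Nat.ceil_lt_add_one (show 0 ≤ Real.exp τ * x by positivity)
  have hn3 : (1 : ℝ) ≤ (⌈Real.exp τ * x⌉₊ : ℝ) := by
    exact_mod_cast Nat.ceil_pos.mpr (show 0 < Real.exp τ * x by positivity)
  generalize (⌈Real.exp τ * x⌉₊ : ℝ) = n at *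
  generalize Real.exp (-τ) = e at *
  generalize Real.exp τ = E at *
  have he : e ≤ 1 / 2 := by nlinarith
  have h1 : 0 < 1 - e := by linarith
  have hL1 := Real.log_le_sub_one_of_pos h1
  have hL2 := Real.one_sub_inv_le_log_of_pos h1
  have hinv : (1 - e)⁻¹ ≤ 1 + e + 2 * e ^ 2 := by
    rw [inv_le_iff_one_le_mul₀ h1]
    nlinarith [mul_nonneg (sq_nonneg e) (show 0 ≤ 1 - 2 * e by linarith)]
  have hL3 : -(e + 2 * e ^ 2) ≤ Real.log (1 - e) := by linarith
  generalize Real.log (1 - e) = L at *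
  have hm0 : 0 ≤ n - 1 := by linarith
  have hx' : E * x * e = x := by
    rw [mul_right_comm, hEe, one_mul]
  have hm1 : (n - 1) * e ≤ x := by
    have := mul_le_mul_of_nonneg_right (show n - 1 ≤ E * x by linarith) he0.le
    linarith
  have hm2 : x - e ≤ (n - 1) * e := by
    have := mul_le_mul_of_nonneg_right hn1 he0.le
    linarith
  have hu := mul_le_mul_of_nonneg_left hL1 hm0
  have hl := mul_le_mul_of_nonneg_left hL3 hm0
  have hme := mul_le_mul_of_nonneg_right hm1 he0.le
  have hxe : 0 < x * e := by positivity
  rw [abs_le]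
  constructor <;> nlinarith
end

section
/- For every λ with 0 < λ < 1, the Borel distribution B(λ, j) = λ^{j−1} j^{j−1} e^{−λj}/j! (j = 1, 2, 3, …) satisfies Σ_{j=1}^{∞} B(λ, j) = 1 and Σ_{j=1}^{∞} j B(λ, j) = (1 − λ)^{−1}. -/
open Filter Topology in
/-- Analyticity of the Borel-type series on `(0,1)`. -/
lemma borel_aux_analytic (a : ℕ → ℝ) (ha : ∀ n, |a n| ≤ Real.exp (n + 1)) :
    AnalyticOnNhd ℝ (fun x : ℝ => Real.exp (-x) * ∑' n, a n * (x * Real.exp (-x)) ^ n)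
      (Set.Ioo 0 1) := by
  set p := FormalMultilinearSeries.ofScalars ℝ a with hp
  let r : NNReal := ⟨Real.exp (-1), (Real.exp_pos _).le⟩
  have hr : (r : ENNReal) ≤ p.radius := by
    apply FormalMultilinearSeries.le_radius_of_bound (C := Real.exp 1)
    intro n
    rw [hp, FormalMultilinearSeries.ofScalars_norm, Real.norm_eq_abs]
    calc |a n| * (r : ℝ) ^ n ≤ Real.exp (n + 1) * (Real.exp (-1)) ^ n :=
          mul_le_mul_of_nonneg_right (ha n) (by positivity)
      _ = Real.exp 1 := by
          rw [← Real.exp_nat_mul, ← Real.exp_add]; congr 1; ring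
      _ ≤ _ := le_rfl
  have hr0 : (0 : ENNReal) < r := by
    rw [ENNReal.coe_pos]; exact Real.exp_pos (-1)
  have han := (p.hasFPowerSeriesOnBall (hr0.trans_le hr)).analyticOnNhd
  have hsum : p.sum = fun y : ℝ => ∑' n, a n * y ^ n :=
    FormalMultilinearSeries.ofScalarsSum_eq_tsum a
  rw [hsum] at han
  intro x hx
  have h1 : x * Real.exp (-x) ∈ Metric.eball (0 : ℝ) p.radius := by
    refine Metric.eball_subset_eball hr ?_
    rw [Metric.eball_coe, mem_ball_zero_iff, Real.norm_eq_abs,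
      abs_of_pos (mul_pos hx.1 (Real.exp_pos _))]
    change _ < Real.exp (-1)
    have h2 := Real.add_one_lt_exp (x := x - 1) (by linarith [hx.2])
    have h3 : Real.exp (-1) = Real.exp (x - 1) * Real.exp (-x) := by
      rw [← Real.exp_add]; congr 1; ring
    rw [h3]
    exact mul_lt_mul_of_pos_right (by linarith) (Real.exp_pos _)
  have hinner : AnalyticAt ℝ (fun x : ℝ => x * Real.exp (-x)) x := by fun_prop
  have hcomp := AnalyticAt.fun_comp (f := fun x : ℝ => x * Real.exp (-x)) (x := x)
    (han _ h1) hinner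
  have he : AnalyticAt ℝ (fun x : ℝ => Real.exp (-x)) x := by fun_prop
  exact he.mul hcomp

/-- Convergence of the series on `(0,1)`. -/
lemma borel_aux_summable (a : ℕ → ℝ) (ha : ∀ n, |a n| ≤ Real.exp (n + 1)) {x : ℝ}
    (h0 : 0 < x) {q : ℝ} (hq : 0 < q) (h : Real.exp 1 * (x * q) < 1) :
    Summable (fun n => |a n| * (x * q) ^ n) := by
  have hg := (summable_geometric_of_lt_one (by positivity) h).mul_left (Real.exp 1)
  refine Summable.of_nonneg_of_le (fun n => by positivity) (fun n => ?_) hg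
  calc |a n| * (x * q) ^ n ≤ Real.exp (n + 1) * (x * q) ^ n :=
        mul_le_mul_of_nonneg_right (ha n) (by positivity)
    _ = _ := by
        rw [mul_pow (Real.exp 1), ← Real.exp_nat_mul, Real.exp_add, mul_one]; ring

/-- Rearrangement for small `x`. -/
lemma borel_aux_small (a : ℕ → ℝ) (ha : ∀ n, |a n| ≤ Real.exp (n + 1)) (c : ℕ → ℝ)
    (hc : ∀ m, ∑ p ∈ Finset.HasAntidiagonal.antidiagonal m,
      a p.1 * ((-((p.1 : ℝ) + 1)) ^ p.2 / (p.2.factorial : ℝ)) = c m)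
    {x : ℝ} (h0 : 0 < x) (h1 : x < 1 / 10) :
    Real.exp (-x) * ∑' n, a n * (x * Real.exp (-x)) ^ n = ∑' m, c m * x ^ m := by
  have hE : ∀ y : ℝ, HasSum (fun k : ℕ => y ^ k / (k.factorial : ℝ)) (Real.exp y) := by
    intro y
    rw [Real.exp_eq_exp_ℝ]
    exact NormedSpace.expSeries_div_hasSum_exp y
  let u : ℕ × ℕ → ℝ := fun p =>
    a p.1 * x ^ p.1 * ((-((p.1 : ℝ) + 1) * x) ^ p.2 / (p.2.factorial : ℝ))
  have hnorm : ∀ n k : ℕ, ‖u (n, k)‖ =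
      |a n| * x ^ n * ((((n : ℝ) + 1) * x) ^ k / (k.factorial : ℝ)) := by
    intro n k
    have : |(-1 + -(n : ℝ))| = n + 1 := by
      rw [abs_of_nonpos] <;> [ring; linarith [Nat.cast_nonneg (α := ℝ) n]]
    simp only [u, Real.norm_eq_abs, abs_mul, abs_div, abs_pow, abs_of_pos h0, Nat.abs_cast,
      neg_add_rev, this]
  have hu : Summable u := by
    apply Summable.of_norm
    rw [summable_prod_of_nonneg (fun _ => norm_nonneg _)]
    have hs : ∀ n : ℕ, HasSum (fun k => ‖u (n, k)‖)
        (|a n| * x ^ n * Real.exp (((n : ℝ) + 1) * x)) := by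
      intro n
      simp only [hnorm]
      exact (hE _).mul_left _
    refine ⟨fun n => (hs n).summable, ?_⟩
    have hlt : Real.exp 1 * (x * Real.exp x) < 1 := by
      have e1 : Real.exp x ≤ Real.exp 1 := Real.exp_le_exp.2 (by linarith)
      have e2 : Real.exp 1 < 2.8 := by linarith [Real.exp_one_lt_d9]
      have e3 := Real.exp_pos x
      have e4 := Real.exp_pos 1
      calc Real.exp 1 * (x * Real.exp x) ≤ 2.8 * (1/10 * 2.8) := by
            gcongr; linarith
        _ < 1 := by norm_num
    have := (borel_aux_summable a ha h0 (Real.exp_pos x) hlt).mul_left (Real.exp x)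
    refine this.congr fun n => ?_
    rw [(hs n).tsum_eq, mul_pow, ← Real.exp_nat_mul, add_mul, Real.exp_add, one_mul]
    ring
  have hrow : ∀ n : ℕ, HasSum (fun k => u (n, k))
      (a n * x ^ n * Real.exp (-((n : ℝ) + 1) * x)) := fun n => (hE _).mul_left _
  have e1 : ∑' p, u p = Real.exp (-x) * ∑' n, a n * (x * Real.exp (-x)) ^ n := by
    rw [hu.tsum_prod, ← tsum_mul_left]
    refine tsum_congr fun n => ?_
    rw [(hrow n).tsum_eq, mul_pow, ← Real.exp_nat_mul,
      show -((n : ℝ) + 1) * x = -x + n * (-x) by ring, Real.exp_add]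
    ring
  rw [← e1, ← Finset.HasAntidiagonal.sigmaAntidiagonalEquivProd.tsum_eq u]
  have hu' : Summable (fun c => u (Finset.HasAntidiagonal.sigmaAntidiagonalEquivProd c)) :=
    (Finset.HasAntidiagonal.sigmaAntidiagonalEquivProd.summable_iff).2 hu
  rw [hu'.tsum_sigma' (fun n => (hasSum_fintype _).summable)]
  refine tsum_congr fun m => ?_
  rw [tsum_fintype, ← hc m, Finset.sum_mul]
  rw [← Finset.sum_coe_sort (Finset.HasAntidiagonal.antidiagonal m)]
  refine Finset.sum_congr rfl fun p _ => ?_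
  obtain ⟨⟨i, k⟩, hp⟩ := p
  have : i + k = m := by simpa using hp
  simp only [Finset.HasAntidiagonal.sigmaAntidiagonalEquivProd_apply, u]
  rw [← this, mul_pow, pow_add]
  ring

open Topology Filter in
lemma borel_aux_main (a : ℕ → ℝ) (ha : ∀ n, |a n| ≤ Real.exp (n + 1)) (c : ℕ → ℝ)
    (hc : ∀ m, ∑ p ∈ Finset.HasAntidiagonal.antidiagonal m,
      a p.1 * ((-((p.1 : ℝ) + 1)) ^ p.2 / (p.2.factorial : ℝ)) = c m)
    (g : ℝ → ℝ) (hg : AnalyticOnNhd ℝ g (Set.Ioo 0 1))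
    (hgc : ∀ x ∈ Set.Ioo (0 : ℝ) (1 / 10), ∑' m, c m * x ^ m = g x)
    {x : ℝ} (h0 : 0 < x) (h1 : x < 1) :
    HasSum (fun n : ℕ => a n * x ^ n * Real.exp (-(x * ((n : ℝ) + 1)))) (g x) := by
  have key := (borel_aux_analytic a ha).eqOn_of_preconnected_of_eventuallyEq hg
    isPreconnected_Ioo (z₀ := 1 / 20) (by norm_num) (by
      filter_upwards [Ioo_mem_nhds (show (0 : ℝ) < 1 / 20 by norm_num)
        (show (1 : ℝ) / 20 < 1 / 10 by norm_num)] with y hy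
      rw [borel_aux_small a ha c hc hy.1 hy.2, hgc y hy])
  have hx := key ⟨h0, h1⟩
  simp only at hx
  rw [← hx]
  have hlt : Real.exp 1 * (x * Real.exp (-x)) < 1 := by
    have h2 := Real.add_one_lt_exp (x := x - 1) (by linarith)
    have h3 : Real.exp 1 * Real.exp (-x) * Real.exp (x - 1) = 1 := by
      rw [← Real.exp_add, ← Real.exp_add, Real.exp_eq_one_iff]; ring
    have h4 : 0 < Real.exp 1 * Real.exp (-x) := by positivity
    nlinarith
  have hs : Summable (fun n => a n * (x * Real.exp (-x)) ^ n) := by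
    apply Summable.of_norm
    refine (borel_aux_summable a ha h0 (Real.exp_pos _) hlt).congr fun n => ?_
    rw [norm_mul, Real.norm_eq_abs, Real.norm_of_nonneg (by positivity)]
  have hsum := hs.hasSum.mul_left (Real.exp (-x))
  refine Eq.mp (congrArg (fun f : ℕ → ℝ => HasSum f _) (funext fun n => ?_)) hsum
  rw [mul_pow, ← Real.exp_nat_mul,
      show -(x * ((n : ℝ) + 1)) = -x + n * (-x) by ring, Real.exp_add]
  ring

/-- Finite differences of powers. -/
lemma borel_aux_diff (m j : ℕ) :
    ∑ p ∈ Finset.HasAntidiagonal.antidiagonal m,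
      ((p.1 : ℝ) + 1) ^ j * ((-1) ^ p.2 / ((p.1.factorial : ℝ) * (p.2.factorial : ℝ))) =
    (fwdDiff (1 : ℝ))^[m] (fun r : ℝ => r ^ j) 1 / m.factorial := by
  rw [fwdDiff_iter_eq_sum_shift, Finset.Nat.sum_antidiagonal_eq_sum_range_succ_mk,
    Finset.sum_div]
  refine Finset.sum_congr rfl fun k hk => ?_
  have hk' : k ≤ m := Nat.lt_succ_iff.1 (Finset.mem_range.1 hk)
  have := Nat.choose_mul_factorial_mul_factorial hk'
  have h2 : (m.choose k : ℝ) * k.factorial * (m - k).factorial = m.factorial := by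
    exact_mod_cast this
  have h3 : (k.factorial : ℝ) ≠ 0 := by positivity
  have h4 : ((m - k).factorial : ℝ) ≠ 0 := by positivity
  have h5 : (m.choose k : ℝ) ≠ 0 := by
    exact_mod_cast (Nat.choose_pos hk').ne'
  simp only [zsmul_eq_mul, nsmul_eq_mul, mul_one, Int.cast_mul, Int.cast_pow, Int.cast_neg,
    Int.cast_one, Int.cast_natCast]
  rw [← h2, add_comm (1 : ℝ) k]
  field_simp

/-- The Borel distribution `B(λ,j) = λ^{j-1} j^{j-1} e^{-λj}/j!` (`j = 1, 2, …`) is a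
probability distribution with mean `(1-λ)⁻¹` for every `0 < λ < 1`:
`∑_{j≥1} B(λ,j) = 1` and `∑_{j≥1} j B(λ,j) = (1-λ)⁻¹`, both series being convergent. -/
theorem borel_distribution_moments
    (B : ℝ → ℕ → ℝ)
    (hB : ∀ (lam : ℝ) (j : ℕ), 1 ≤ j →
      B lam j = lam ^ (j - 1) * (j : ℝ) ^ (j - 1) * Real.exp (-(lam * j)) / (j.factorial : ℝ))
    (lam : ℝ) (h0 : 0 < lam) (h1 : lam < 1) :
    Summable (fun j : ℕ => B lam (j + 1)) ∧
    (∑' j : ℕ, B lam (j + 1)) = 1 ∧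
    Summable (fun j : ℕ => ((j : ℝ) + 1) * B lam (j + 1)) ∧
    (∑' j : ℕ, ((j : ℝ) + 1) * B lam (j + 1)) = (1 - lam)⁻¹ := by
  have hb2 : ∀ n : ℕ, |((n : ℝ) + 1) ^ n / (n.factorial : ℝ)| ≤ Real.exp (n + 1) := by
    intro n
    rw [abs_of_nonneg (by positivity)]
    exact Real.pow_div_factorial_le_exp _ (by positivity) n
  have hb1 : ∀ n : ℕ, |((n : ℝ) + 1) ^ n / ((n + 1).factorial : ℝ)| ≤ Real.exp (n + 1) := by
    intro n
    refine le_trans ?_ (hb2 n)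
    rw [abs_of_nonneg (by positivity), abs_of_nonneg (by positivity)]
    gcongr
    omega
  have H1 := borel_aux_main (fun n : ℕ => ((n : ℝ) + 1) ^ n / ((n + 1).factorial : ℝ)) hb1
    (fun m => if m = 0 then 1 else 0) (by
      intro m
      rcases m with _ | m
      · simp
      · have := borel_aux_diff (m + 1) m
        rw [fwdDiff_iter_pow_eq_zero_of_lt (Nat.lt_succ_self m)] at this
        simp only [Pi.zero_apply, zero_div] at this
        rw [if_neg (Nat.succ_ne_zero m), ← this]
        refine Finset.sum_congr rfl fun p hp => ?_
        obtain ⟨i, k⟩ := p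
        have hik : i + k = m + 1 := by simpa using hp
        have hpow : ((i : ℝ) + 1) ^ i * ((i : ℝ) + 1) ^ k = ((i : ℝ) + 1) ^ m * ((i : ℝ) + 1) := by
          rw [← pow_add, hik, pow_succ]
        have hi : (i : ℝ) + 1 ≠ 0 := by positivity
        have hf : (i.factorial : ℝ) ≠ 0 := by positivity
        have hf' : (k.factorial : ℝ) ≠ 0 := by positivity
        simp only
        rw [neg_pow ((i : ℝ) + 1) k, Nat.factorial_succ]
        push_cast
        field_simp
        linear_combination hpow)
    (fun _ => 1) analyticOnNhd_const (by
      intro x _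
      rw [tsum_eq_single 0 (by intro b hb; simp [hb])]
      simp) h0 h1
  have H2 := borel_aux_main (fun n : ℕ => ((n : ℝ) + 1) ^ n / (n.factorial : ℝ)) hb2
    (fun _ => 1) (by
      intro m
      have := borel_aux_diff m m
      rw [fwdDiff_iter_eq_factorial] at this
      have hm : (m.factorial : ℝ) ≠ 0 := by positivity
      simp only [Pi.natCast_apply, div_self hm] at this
      refine Eq.trans ?_ this
      refine Finset.sum_congr rfl fun p hp => ?_
      obtain ⟨i, k⟩ := p
      have hik : i + k = m := by simpa using hp
      simp only
      rw [neg_pow ((i : ℝ) + 1) k, ← hik, pow_add]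
      field_simp)
    (fun x => (1 - x)⁻¹) (by
      intro x hx
      have hne : 1 - x ≠ 0 := by linarith [hx.2]
      exact AnalyticAt.inv (by fun_prop) hne) (by
      intro x hx
      simp only [one_mul]
      exact tsum_geometric_of_lt_one hx.1.le (by linarith [hx.2])) h0 h1
  have E1 : (fun j : ℕ => B lam (j + 1)) = fun n : ℕ =>
      ((n : ℝ) + 1) ^ n / ((n + 1).factorial : ℝ) * lam ^ n *
        Real.exp (-(lam * ((n : ℝ) + 1))) := by
    funext n
    rw [hB lam (n + 1) (by omega)]
    simp only [Nat.add_sub_cancel, Nat.cast_add, Nat.cast_one]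
    ring
  have E2 : (fun j : ℕ => ((j : ℝ) + 1) * B lam (j + 1)) = fun n : ℕ =>
      ((n : ℝ) + 1) ^ n / (n.factorial : ℝ) * lam ^ n *
        Real.exp (-(lam * ((n : ℝ) + 1))) := by
    funext n
    rw [congrFun E1 n, Nat.factorial_succ]
    have hi : (n : ℝ) + 1 ≠ 0 := by positivity
    push_cast
    field_simp
  rw [E1, E2]
  exact ⟨H1.summable, H1.tsum_eq, H2.summable, H2.tsum_eq⟩
end

section
/- Let u_*(s) = (1 + 2s)^{−1/2} and φ_*(s) = (1 + 2s)^{1/2} − 1 (principal branch). Then for every t ≥ 0 and every s_0 ∈ ℂ with Re(s_0) ≥ 0, setting s^* = e^{2t}(s_0 − φ_*(s_0)(1 − e^{−t})), one has 1 + 2s^* ∉ (−∞, 0], the denominator 1 − u_*(s_0)(1 − e^{−t}) is nonzero, and u_*(s^*) = e^{−t} u_*(s_0) / (1 − u_*(s_0)(1 − e^{−t})). -/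
/-- The transform `u_*(s) = (1+2s)^{-1/2}` of the self-similar mass profile for the
additive kernel is stationary along its characteristics
`s^* = e^{2t}(s₀ - φ_*(s₀)(1 - e^{-t}))`, where `φ_*(s) = (1+2s)^{1/2} - 1`: for `t ≥ 0`
and `Re s₀ ≥ 0`, one has `1 + 2s^* ∉ (-∞,0]`, the denominator `1 - u_*(s₀)(1 - e^{-t})`
is nonzero, and `u_*(s^*) = e^{-t} u_*(s₀) / (1 - u_*(s₀)(1 - e^{-t}))`. -/
theorem stationary_solution_additive_kernel
    (us φs : ℂ → ℂ)
    (hus : ∀ z : ℂ, us z = (1 + 2 * z) ^ (-(1 / 2) : ℂ))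
    (hφs : ∀ z : ℂ, φs z = (1 + 2 * z) ^ ((1 / 2) : ℂ) - 1)
    (t : ℝ) (ht : 0 ≤ t) (s0 : ℂ) (hs0 : 0 ≤ s0.re)
    (sstar : ℂ)
    (hsstar : sstar = (Real.exp (2 * t) : ℂ) * (s0 - φs s0 * (1 - (Real.exp (-t) : ℂ)))) :
    (¬ ∃ r : ℝ, r ≤ 0 ∧ 1 + 2 * sstar = (r : ℂ)) ∧
    1 - us s0 * (1 - (Real.exp (-t) : ℂ)) ≠ 0 ∧
    us sstar = (Real.exp (-t) : ℂ) * us s0 / (1 - us s0 * (1 - (Real.exp (-t) : ℂ))) := by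
  have hh : ((1 / 2 : ℂ)) = 2⁻¹ := by norm_num
  obtain ⟨w, hw⟩ : ∃ w : ℂ, w = (1 + 2 * s0) ^ (2⁻¹ : ℂ) := ⟨_, rfl⟩
  have hw2 : w ^ 2 = 1 + 2 * s0 := by
    rw [hw]; exact Complex.cpow_ofNat_inv_pow _ 2
  have hre0 : 0 ≤ w.re := by
    rw [hw, Complex.cpow_inv_two_re]; positivity
  have hre : 1 ≤ w.re := by
    have h := congrArg Complex.re hw2
    simp [pow_two] at h
    nlinarith [mul_self_nonneg w.im]
  have hw0 : w ≠ 0 := by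
    intro h; rw [h] at hre; simp at hre; linarith
  have hu0 : us s0 = w⁻¹ := by rw [hus, hh, Complex.cpow_neg, hw]
  have hp0 : φs s0 = w - 1 := by rw [hφs, hh, hw]
  have hE2 : Real.exp (2 * t) = Real.exp t ^ 2 := by rw [← Real.exp_nat_mul]; norm_num
  have hEq : Real.exp t * Real.exp (-t) = 1 := by rw [← Real.exp_add]; simp
  have hE := Real.exp_pos t
  have hq := Real.exp_pos (-t)
  rw [hE2, hp0] at hsstar
  rw [hu0]
  generalize Real.exp t = E at *
  generalize Real.exp (-t) = q at *
  have hEqC : (E : ℂ) * q = 1 := by exact_mod_cast hEq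
  have hE0 : (E : ℂ) ≠ 0 := by exact_mod_cast hE.ne'
  have hdre : 0 < (w - (1 - (q : ℂ))).re := by simp; linarith
  have hd0 : w - (1 - (q : ℂ)) ≠ 0 := by
    intro h; rw [h] at hdre; simp at hdre
  have hvre : 0 < ((E : ℂ) * (w - (1 - (q : ℂ)))).re := by
    rw [Complex.re_ofReal_mul]; exact mul_pos hE hdre
  have hv2 : 1 + 2 * sstar = ((E : ℂ) * (w - (1 - (q : ℂ)))) ^ 2 := by
    rw [hsstar]; push_cast
    linear_combination (-(E : ℂ) ^ 2) * hw2 - (E * q + 1) * hEqC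
  have hus1 : us sstar = ((E : ℂ) * (w - (1 - (q : ℂ))))⁻¹ := by
    rw [hus, hh, Complex.cpow_neg, hv2, Complex.sq_cpow_two_inv hvre]
  have hden : 1 - w⁻¹ * (1 - (q : ℂ)) = w⁻¹ * (w - (1 - (q : ℂ))) := by
    field_simp
  refine ⟨?_, ?_, ?_⟩
  · rintro ⟨r, hr, h⟩
    rw [hv2] at h
    generalize (E : ℂ) * (w - (1 - (q : ℂ))) = v at *
    have h1 := congrArg Complex.re h
    have h2 := congrArg Complex.im h
    simp [pow_two] at h1 h2
    have h3 : v.im = 0 := by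
      have : v.re * v.im = 0 := by linarith
      exact (mul_eq_zero.mp this).resolve_left hvre.ne'
    rw [h3] at h1
    nlinarith [mul_pos hvre hvre]
  · rw [hden]; exact mul_ne_zero (inv_ne_zero hw0) hd0
  · rw [hus1, hden, mul_comm (q : ℂ) w⁻¹, mul_div_mul_left _ _ (inv_ne_zero hw0), mul_inv,
      div_eq_mul_inv, inv_eq_of_mul_eq_one_right hEqC]
end

section
/- For t ≥ 0 define F(t, x̂) = e^{−2t} Σ_{1 ≤ j < e^{2t} x̂} e^{t} (1 − e^{−t})^{j−1} j^{j} e^{−(1−e^{−t})j}/j! for x̂ > 0, and let F_*(x̂) = ∫_0^{x̂} (2π)^{−1/2} ŷ^{−1/2} e^{−ŷ/2} dŷ. Then there exist constants C and t_0 ≥ 0 such that for all t ≥ t_0, sup_{x̂>0} |F(t, x̂) − F_*(x̂)| ≤ C e^{−t}. -/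
open MeasureTheory

lemma stir_upper (n : ℕ) : Real.log (Stirling.stirlingSeq (n+1)) - 1/(2*((n:ℝ)+1)) ≤ Real.log (Real.sqrt Real.pi) := by
  have hm : Monotone (fun n : ℕ => Real.log (Stirling.stirlingSeq (n+1)) - 1/(2*((n:ℝ)+1))) := by
    apply monotone_nat_of_le_succ
    intro n
    have h := Stirling.log_stirlingSeq_sdiff_le (n+1)
    have h2 : 1/(12*((n:ℝ)+1)*((n:ℝ)+1+1)) ≤ 1/(2*((n:ℝ)+1)) - 1/(2*((n:ℝ)+1+1)) := by
      have hn : (0:ℝ) ≤ n := n.cast_nonneg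
      have : 1/(2*((n:ℝ)+1)) - 1/(2*((n:ℝ)+1+1)) = 1/(2*((n:ℝ)+1)*((n:ℝ)+2)) := by
        field_simp
        ring
      rw [this]
      apply one_div_le_one_div_of_le
      · positivity
      · nlinarith
    push_cast at h ⊢
    have h' := h.trans h2
    linarith
  have hs : Filter.Tendsto (fun n : ℕ => Stirling.stirlingSeq (n+1)) Filter.atTop (nhds (Real.sqrt Real.pi)) :=
    (Filter.tendsto_add_atTop_iff_nat 1).2 Stirling.tendsto_stirlingSeq_sqrt_pi
  have hl := hs.log (by positivity)
  have h0 : Filter.Tendsto (fun n : ℕ => 1/(2*((n:ℝ)+1))) Filter.atTop (nhds 0) := by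
    have := (tendsto_one_div_add_atTop_nhds_zero_nat (𝕜 := ℝ)).const_mul (1/2)
    simp only [mul_zero] at this
    refine this.congr fun n => ?_
    field_simp
  have := (hl.sub h0)
  rw [sub_zero] at this
  exact hm.ge_of_tendsto this n

lemma stir (j : ℕ) (hj : 1 ≤ j) :
    (j:ℝ)^j * Real.exp (-j) / j.factorial ≤ (Real.sqrt (2*Real.pi))⁻¹ * (j:ℝ)^(-(1:ℝ)/2) ∧
    (Real.sqrt (2*Real.pi))⁻¹ * (j:ℝ)^(-(1:ℝ)/2) * (1 - 1/(2*j)) ≤ (j:ℝ)^j * Real.exp (-j) / j.factorial := by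
  obtain ⟨n, rfl⟩ : ∃ n, j = n+1 := ⟨j-1, by omega⟩
  have hu := stir_upper n
  have hl := Stirling.sqrt_pi_le_stirlingSeq (n := n+1) (by omega)
  have hpi : 0 < Real.sqrt Real.pi := by positivity
  set s := Stirling.stirlingSeq (n+1) with hs
  have spos : 0 < s := hpi.trans_le hl
  set x : ℝ := ((n+1:ℕ):ℝ) with hx
  have hx0 : 0 < x := by positivity
  have hxr : x ^ (-(1:ℝ)/2) = (Real.sqrt x)⁻¹ := by
    rw [Real.sqrt_eq_rpow, ← Real.rpow_neg hx0.le]; norm_num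
  have e1 : x^(n+1) * Real.exp (-x) / (n+1).factorial = (Real.sqrt 2)⁻¹ * (Real.sqrt x)⁻¹ * s⁻¹ := by
    rw [hs, Stirling.stirlingSeq, ← hx, Real.sqrt_mul (by norm_num), div_pow, Real.exp_neg,
      ← Real.exp_nat_mul, ← hx, mul_one]
    field_simp
  rw [e1, hxr, Real.sqrt_mul (by norm_num)]
  have A : s⁻¹ ≤ (Real.sqrt Real.pi)⁻¹ := inv_anti₀ hpi hl
  have B : (Real.sqrt Real.pi)⁻¹ * (1 - 1/(2*x)) ≤ s⁻¹ := by
    have h1 : Real.log s - Real.log (Real.sqrt Real.pi) ≤ 1/(2*x) := by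
      rw [hx]; push_cast; linarith
    have h2 := Real.add_one_le_exp (-(Real.log s - Real.log (Real.sqrt Real.pi)))
    rw [neg_sub, Real.exp_sub, Real.exp_log hpi, Real.exp_log spos] at h2
    rw [inv_mul_le_iff₀ hpi, ← div_eq_mul_inv]
    linarith
  have hp : 0 ≤ (Real.sqrt 2)⁻¹ * (Real.sqrt x)⁻¹ := by positivity
  constructor
  · calc _ ≤ (Real.sqrt 2)⁻¹ * (Real.sqrt x)⁻¹ * (Real.sqrt Real.pi)⁻¹ := by gcongr
      _ = _ := by rw [mul_inv]; ring
  · calc _ = (Real.sqrt 2)⁻¹ * (Real.sqrt x)⁻¹ * ((Real.sqrt Real.pi)⁻¹ * (1 - 1/(2*x))) := by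
          rw [mul_inv]; ring
      _ ≤ _ := by gcongr

lemma wt (e : ℝ) (he : 0 < e) (he2 : e ≤ 1/2) (j : ℕ) (hj : 1 ≤ j) :
    |(1-e)^(j-1) * Real.exp (e*j) - Real.exp (-(e^2/2*j))| ≤ 8*e*Real.exp (-(e^2/4*j)) := by
  have hlam : 0 < 1 - e := by linarith
  obtain ⟨n, rfl⟩ : ∃ n, j = n+1 := ⟨j-1, by omega⟩
  have hea : |e| < 1 := by rw [abs_of_pos he]; linarith
  have hT := Real.abs_log_sub_add_sum_range_le (x := e) hea 2
  set g := -Real.log (1-e) - e with hg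
  have hg1 : e^2/2 ≤ g := by
    have h := sum_le_hasSum (Finset.range 2) (fun i _ => by positivity)
      (Real.hasSum_pow_div_log_of_abs_lt_one hea)
    simp [Finset.sum_range_succ] at h
    norm_num at h
    linarith
  have hg2 : g ≤ e^2/2 + 2*e^3 := by
    rw [abs_of_pos he] at hT
    have : e^3/(1-e) ≤ 2*e^3 := by
      rw [div_le_iff₀ hlam]; nlinarith [pow_pos he 3]
    have h := (abs_le.1 (hT.trans this)).1
    simp [Finset.sum_range_succ] at h
    norm_num at h
    linarith
  have hw : (1-e)^(n+1-1) * Real.exp (e*((n+1:ℕ):ℝ)) =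
      (1-e)⁻¹ * Real.exp (-(g*((n+1:ℕ):ℝ))) := by
    have : -(g*((n+1:ℕ):ℝ)) = ((n+1:ℕ):ℝ) * Real.log (1-e) + e*((n+1:ℕ):ℝ) := by rw [hg]; ring
    rw [this, Real.exp_add, Real.exp_nat_mul, Real.exp_log hlam, pow_succ]
    simp only [Nat.add_sub_cancel]
    field_simp
  rw [hw]
  set x : ℝ := ((n+1:ℕ):ℝ) with hx
  have hx0 : 0 < x := by positivity
  have i1 : 1 ≤ (1-e)⁻¹ := (one_le_inv₀ hlam).2 (by linarith)
  have i2 : (1-e)⁻¹ ≤ 1 + 2*e := by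
    rw [inv_le_iff_one_le_mul₀ hlam]; nlinarith
  have hE : Real.exp (-(e^2/2*x)) = Real.exp (-(e^2/4*x)) * Real.exp (-(e^2/4*x)) := by
    rw [← Real.exp_add]; ring_nf
  have hq : (1 + e^2/4*x) * Real.exp (-(e^2/4*x)) ≤ 1 := by
    have := Real.add_one_le_exp (e^2/4*x)
    rw [Real.exp_neg, ← div_eq_mul_inv, div_le_one (Real.exp_pos _)]
    linarith
  have key : (2*e + 2*e^3*x) * Real.exp (-(e^2/2*x)) ≤ 8*e*Real.exp (-(e^2/4*x)) := by
    set q := Real.exp (-(e^2/4*x)) with hqq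
    have q0 : 0 < q := Real.exp_pos _
    rw [hE]
    have : (2*e + 2*e^3*x) * (q*q) ≤ 8*e*q*((1 + e^2/4*x) * q) := by
      have : 0 ≤ 6*e*(q*q) := by positivity
      nlinarith
    refine this.trans ?_
    have : 0 < 8*e*q := by positivity
    nlinarith
  have u : Real.exp (-(g*x)) ≤ Real.exp (-(e^2/2*x)) := by
    apply Real.exp_le_exp.2; nlinarith
  have l : Real.exp (-(e^2/2*x)) * (1 - 2*e^3*x) ≤ Real.exp (-(g*x)) := by
    have h1 := Real.add_one_le_exp (-(2*e^3*x))
    calc _ ≤ Real.exp (-(e^2/2*x)) * Real.exp (-(2*e^3*x)) := by gcongr; linarith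
      _ = Real.exp (-(e^2/2*x) + -(2*e^3*x)) := by rw [Real.exp_add]
      _ ≤ _ := by apply Real.exp_le_exp.2; nlinarith
  refine le_trans ?_ key
  set E := Real.exp (-(e^2/2*x))
  set G := Real.exp (-(g*x))
  have E0 : 0 < E := Real.exp_pos _
  have G0 : 0 < G := Real.exp_pos _
  have p1 : 0 ≤ e^3*x*E := by positivity
  have p2 : 0 ≤ e*E := by positivity
  rw [abs_le]
  constructor
  · have : G ≤ (1-e)⁻¹ * G := by nlinarith
    nlinarith
  · have : (1-e)⁻¹ * G ≤ (1+2*e) * E := by gcongr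
    nlinarith

section sumint
variable {f : ℝ → ℝ}

lemma si_split (int : IntegrableOn f (Set.Ioi 0)) (n : ℕ) :
    ∫ y in Set.Ioc (0:ℝ) ((n:ℝ)+1), f y
      = (∫ y in Set.Ioc (0:ℝ) n, f y) + ∫ y in Set.Ioc (n:ℝ) ((n:ℝ)+1), f y := by
  have hn : (0:ℝ) ≤ n := n.cast_nonneg
  rw [← setIntegral_union (Set.Ioc_disjoint_Ioc_of_le le_rfl) measurableSet_Ioc
    (int.mono_set fun y hy => hy.1) (int.mono_set fun y hy => lt_of_le_of_lt hn hy.1),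
    Set.Ioc_union_Ioc_eq_Ioc hn (by linarith)]

lemma si_lower (anti : ∀ x y, 0 < x → x ≤ y → f y ≤ f x)
    (int : IntegrableOn f (Set.Ioi 0)) (n : ℕ) :
    f ((n:ℝ)+1) ≤ ∫ y in Set.Ioc (n:ℝ) ((n:ℝ)+1), f y := by
  have hn : (0:ℝ) ≤ n := n.cast_nonneg
  have h : ∫ y in Set.Ioc (n:ℝ) ((n:ℝ)+1), f ((n:ℝ)+1) ≤ ∫ y in Set.Ioc (n:ℝ) ((n:ℝ)+1), f y := by
    apply setIntegral_mono_on (by simp) (int.mono_set fun y hy => lt_of_le_of_lt hn hy.1)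
      measurableSet_Ioc
    intro y hy
    exact anti _ _ (lt_of_le_of_lt hn hy.1) hy.2
  simpa using h

lemma si_upper (anti : ∀ x y, 0 < x → x ≤ y → f y ≤ f x)
    (int : IntegrableOn f (Set.Ioi 0)) (n : ℕ) (hn : 1 ≤ n) :
    ∫ y in Set.Ioc (n:ℝ) ((n:ℝ)+1), f y ≤ f n := by
  have hn : (0:ℝ) < n := by exact_mod_cast hn
  have h : ∫ y in Set.Ioc (n:ℝ) ((n:ℝ)+1), f y ≤ ∫ y in Set.Ioc (n:ℝ) ((n:ℝ)+1), f n := by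
    apply setIntegral_mono_on (int.mono_set fun y hy => hn.trans hy.1) (by simp)
      measurableSet_Ioc
    intro y hy
    exact anti _ _ hn hy.1.le
  simpa using h

lemma si_sum_le (anti : ∀ x y, 0 < x → x ≤ y → f y ≤ f x)
    (int : IntegrableOn f (Set.Ioi 0)) (n : ℕ) :
    ∑ j ∈ Finset.Ico 1 (n+1), f j ≤ ∫ y in Set.Ioc (0:ℝ) n, f y := by
  induction n with
  | zero => simp
  | succ n ih =>
    rw [Finset.sum_Ico_succ_top (by omega)]
    push_cast
    rw [si_split int]
    exact add_le_add ih (si_lower anti int n)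

lemma si_le_sum (anti : ∀ x y, 0 < x → x ≤ y → f y ≤ f x)
    (int : IntegrableOn f (Set.Ioi 0)) (n : ℕ) :
    ∫ y in Set.Ioc (0:ℝ) ((n:ℝ)+1), f y
      ≤ (∫ y in Set.Ioc (0:ℝ) 1, f y) + ∑ j ∈ Finset.Ico 1 (n+1), f j := by
  induction n with
  | zero => simp
  | succ n ih =>
    rw [Finset.sum_Ico_succ_top (by omega), si_split int, ← add_assoc]
    push_cast at ih ⊢
    have := si_upper anti int (n+1) (by omega)
    push_cast at this
    exact add_le_add ih this

lemma si_abs (nonneg : ∀ x, 0 < x → 0 ≤ f x) (anti : ∀ x y, 0 < x → x ≤ y → f y ≤ f x)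
    (int : IntegrableOn f (Set.Ioi 0)) (X : ℝ) (hX : 0 < X) :
    |(∑ j ∈ Finset.Ico 1 ⌈X⌉₊, f j) - ∫ y in Set.Ioc (0:ℝ) X, f y| ≤
      ∫ y in Set.Ioc (0:ℝ) 1, f y := by
  obtain ⟨n, hn⟩ : ∃ n, ⌈X⌉₊ = n+1 := ⟨⌈X⌉₊-1, by have := Nat.ceil_pos.2 hX; omega⟩
  have h1 : (n:ℝ) ≤ X := by
    have := Nat.ceil_lt_add_one hX.le
    rw [hn] at this; push_cast at this; linarith
  have h2 : X ≤ (n:ℝ)+1 := by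
    have := Nat.le_ceil X
    rw [hn] at this; push_cast at this; linarith
  rw [hn]
  have mono : ∀ a b : ℝ, a ≤ b → ∫ y in Set.Ioc (0:ℝ) a, f y ≤ ∫ y in Set.Ioc (0:ℝ) b, f y := by
    intro a b hab
    apply setIntegral_mono_set (int.mono_set fun y hy => hy.1)
    · refine (ae_restrict_iff' measurableSet_Ioc).2 (Filter.Eventually.of_forall ?_)
      intro y hy
      exact nonneg y hy.1
    · exact (Set.Ioc_subset_Ioc_right hab).eventuallyLE
  have := si_sum_le anti int n
  have := si_le_sum anti int n
  have := mono _ _ h1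
  have := mono _ _ h2
  have p : 0 ≤ ∫ y in Set.Ioc (0:ℝ) 1, f y := setIntegral_nonneg measurableSet_Ioc fun y hy => nonneg y hy.1
  rw [abs_le]
  constructor <;> linarith

lemma si_bound (nonneg : ∀ x, 0 < x → 0 ≤ f x) (anti : ∀ x y, 0 < x → x ≤ y → f y ≤ f x)
    (int : IntegrableOn f (Set.Ioi 0)) (N : ℕ) :
    ∑ j ∈ Finset.Ico 1 N, f j ≤ ∫ y in Set.Ioi (0:ℝ), f y := by
  rcases N with _ | n
  · simp
    exact setIntegral_nonneg measurableSet_Ioi fun y hy => nonneg y hy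
  · refine (si_sum_le anti int n).trans ?_
    apply setIntegral_mono_set int
    · refine (ae_restrict_iff' measurableSet_Ioi).2 (Filter.Eventually.of_forall ?_)
      intro y hy
      exact nonneg y hy
    · exact Set.Ioc_subset_Ioi_self.eventuallyLE
end sumint

/-- the comparison function -/
noncomputable def hfun (c : ℝ) (y : ℝ) : ℝ := y ^ (-(1:ℝ)/2) * Real.exp (-(c*y))

lemma hfun_nonneg (c : ℝ) : ∀ x, 0 < x → 0 ≤ hfun c x := by
  intro x hx; unfold hfun; positivity

lemma hfun_anti (c : ℝ) (hc : 0 < c) : ∀ x y, 0 < x → x ≤ y → hfun c y ≤ hfun c x := by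
  intro x y hx hxy
  unfold hfun
  have h1 : y ^ (-(1:ℝ)/2) ≤ x ^ (-(1:ℝ)/2) := Real.rpow_le_rpow_of_nonpos hx hxy (by norm_num)
  gcongr

lemma hfun_int (c : ℝ) (hc : 0 < c) : IntegrableOn (hfun c) (Set.Ioi 0) := by
  have := integrableOn_rpow_mul_exp_neg_mul_rpow (p := 1) (s := -(1:ℝ)/2) (by norm_num) one_pos hc
  simp only [Real.rpow_one, neg_mul] at this
  exact this

lemma hfun_val (e : ℝ) (he : 0 < e) : ∫ y in Set.Ioi (0:ℝ), hfun (e^2/4) y = 2*Real.sqrt Real.pi/e := by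
  have := Real.integral_rpow_mul_exp_neg_mul_Ioi (a := 1/2) (r := e^2/4) (by norm_num) (by positivity)
  rw [Real.Gamma_one_half_eq, show ((1:ℝ)/2 - 1) = -(1:ℝ)/2 by norm_num, ← Real.sqrt_eq_rpow,
    show 1/(e^2/4) = (2/e)^2 by field_simp; norm_num, Real.sqrt_sq (by positivity)] at this
  unfold hfun
  rw [this]; ring

lemma hfun_one (c : ℝ) (hc : 0 < c) : ∫ y in Set.Ioc (0:ℝ) 1, hfun c y ≤ 2 := by
  have h0 : IntervalIntegrable (fun y : ℝ => y ^ (-(1:ℝ)/2)) volume 0 1 :=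
    intervalIntegral.intervalIntegrable_rpow' (by norm_num)
  have hi : ∫ y in (0:ℝ)..1, y ^ (-(1:ℝ)/2) = 2 := by
    rw [integral_rpow (Or.inl (by norm_num))]; norm_num
  rw [← hi, intervalIntegral.integral_of_le zero_le_one]
  apply setIntegral_mono_on ((hfun_int c hc).mono_set fun y hy => hy.1)
    ((intervalIntegrable_iff_integrableOn_Ioc_of_le zero_le_one).1 h0) measurableSet_Ioc
  intro y hy
  unfold hfun
  have h1 : Real.exp (-(c*y)) ≤ 1 := by
    apply Real.exp_le_one_iff.2
    have := hy.1
    have : 0 < c*y := by positivity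
    linarith
  have h2 : 0 ≤ y ^ (-(1:ℝ)/2) := Real.rpow_nonneg hy.1.le _
  nlinarith

lemma scale (e : ℝ) (he : 0 < e) (X : ℝ) (hX : 0 < X) :
    ∫ y in Set.Ioc (0 : ℝ) (e^2*X),
      (Real.sqrt (2 * Real.pi))⁻¹ * y ^ (-(1 : ℝ) / 2) * Real.exp (-y / 2)
    = e * ((Real.sqrt (2 * Real.pi))⁻¹ * ∫ y in Set.Ioc (0:ℝ) X, hfun (e^2/2) y) := by
  rw [← intervalIntegral.integral_of_le (by positivity), ← intervalIntegral.integral_of_le hX.le]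
  have := intervalIntegral.mul_integral_comp_mul_left (a := 0) (b := X)
    (f := fun y : ℝ => (Real.sqrt (2 * Real.pi))⁻¹ * y ^ (-(1 : ℝ) / 2) * Real.exp (-y / 2)) (e^2)
  rw [mul_zero] at this
  rw [← this, ← mul_assoc, ← intervalIntegral.integral_const_mul, ← intervalIntegral.integral_const_mul]
  apply intervalIntegral.integral_congr
  intro y hy
  rw [Set.uIcc_of_le hX.le] at hy
  have h : (e^2*y) ^ (-(1 : ℝ) / 2) = e⁻¹ * y ^ (-(1 : ℝ) / 2) := by
    rw [Real.mul_rpow (by positivity) hy.1, ← Real.rpow_natCast, ← Real.rpow_mul he.le]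
    norm_num [Real.rpow_neg_one]
  simp only [hfun, h]
  rw [show -(e^2*y)/2 = -(e^2/2*y) by ring]
  field_simp

lemma term (e : ℝ) (he : 0 < e) (he2 : e ≤ 1/2) (j : ℕ) (hj : 1 ≤ j) :
    |(1-e)^(j-1) * (j:ℝ)^j * Real.exp (-((1-e)*j)) / j.factorial
      - (Real.sqrt (2*Real.pi))⁻¹ * hfun (e^2/2) j| ≤ 8*e*hfun (e^2/4) j + (j:ℝ)^(-(3:ℝ)/2) := by
  obtain ⟨s1, s2⟩ := stir j hj
  have w := wt e he he2 j hj
  have hj0 : (0:ℝ) < j := by exact_mod_cast hj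
  have h3 : (j:ℝ)^(-(3:ℝ)/2) = (j:ℝ)^(-(1:ℝ)/2) * (1/j) := by
    rw [show -(3:ℝ)/2 = -(1:ℝ)/2 + -1 by norm_num, Real.rpow_add hj0, Real.rpow_neg_one, one_div]
  have hk : (Real.sqrt (2*Real.pi))⁻¹ ≤ 1 := by
    apply inv_le_one_of_one_le₀
    rw [Real.one_le_sqrt]
    linarith [Real.pi_gt_three]
  have hk0 : 0 < (Real.sqrt (2*Real.pi))⁻¹ := by positivity
  have hexp : Real.exp (-((1-e)*j)) = Real.exp (-j) * Real.exp (e*j) := by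
    rw [← Real.exp_add]; ring_nf
  have E1 : Real.exp (-(e^2/2*j)) ≤ 1 := Real.exp_le_one_iff.2 (by have : 0 < e^2/2*j := by positivity
                                                                   linarith)
  have E0 := Real.exp_pos (-(e^2/2*j))
  unfold hfun
  rw [h3, hexp]
  have a0 : 0 ≤ (j:ℝ)^j * Real.exp (-j) / j.factorial := by positivity
  have r0 : 0 < (j:ℝ)^(-(1:ℝ)/2) := by positivity
  have key : (1-e)^(j-1) * (j:ℝ)^j * (Real.exp (-j) * Real.exp (e*j)) / j.factorial
      = ((j:ℝ)^j * Real.exp (-j) / j.factorial) * ((1-e)^(j-1) * Real.exp (e*j)) := by ring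
  rw [key]
  set k := (Real.sqrt (2*Real.pi))⁻¹
  set a := (j:ℝ)^j * Real.exp (-j) / j.factorial
  set r := (j:ℝ)^(-(1:ℝ)/2)
  set W := (1-e)^(j-1) * Real.exp (e*j)
  set E := Real.exp (-(e^2/2*j))
  set Q := Real.exp (-(e^2/4*j))
  have Q0 : 0 < Q := Real.exp_pos _
  have hkr : k*r ≤ r := by nlinarith
  have dec : a*W - k*(r*E) = a*(W-E) + (a-k*r)*E := by ring
  have hd : |a - k*r| ≤ r*(1/j) := by
    have hh : 0 < r*(1/j) := by positivity
    have h5 : k*r*(1/(2*j)) ≤ r*(1/j) := by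
      calc k*r*(1/(2*j)) ≤ r*(1/(2*j)) := by gcongr
        _ = r*(1/j)/2 := by field_simp
        _ ≤ _ := by linarith
    rw [abs_le]; constructor <;> nlinarith
  rw [dec]
  refine (abs_add_le _ _).trans ?_
  rw [abs_mul, abs_mul, abs_of_nonneg a0, abs_of_pos E0]
  apply add_le_add
  · calc a * |W-E| ≤ r*(8*e*Q) := by
          gcongr
          exact s1.trans hkr
      _ = _ := by ring
  · calc |a-k*r| * E ≤ |a-k*r| * 1 := by gcongr
      _ ≤ _ := by rw [mul_one]; exact hd

/-- The exponential convergence rate is attained for monodisperse initial data with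
additive kernel `K = x + y`: with
`F(t,xh) = e^{-2t} ∑_{1 ≤ j < e^{2t} xh} e^t (1-e^{-t})^{j-1} j^j e^{-(1-e^{-t})j}/j!`
and `F_*(xh) = ∫_0^xh (2π)^{-1/2} y^{-1/2} e^{-y/2} dy`, there exist constants `C` and
`t₀ ≥ 0` such that `sup_{xh>0} |F(t,xh) - F_*(xh)| ≤ C e^{-t}` for all `t ≥ t₀`. -/
theorem monodisperse_additive_kernel_rate :
    ∃ C t0 : ℝ, 0 ≤ t0 ∧ ∀ t ≥ t0, ∀ xh > (0 : ℝ),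
      |Real.exp (-(2 * t)) *
          (∑ j ∈ Finset.Ico 1 ⌈Real.exp (2 * t) * xh⌉₊,
            Real.exp t * (1 - Real.exp (-t)) ^ (j - 1) * (j : ℝ) ^ j *
              Real.exp (-((1 - Real.exp (-t)) * j)) / (j.factorial : ℝ))
          - ∫ y in Set.Ioc (0 : ℝ) xh,
              (Real.sqrt (2 * Real.pi))⁻¹ * y ^ (-(1 : ℝ) / 2) * Real.exp (-y / 2)|
        ≤ C * Real.exp (-t) := by
  have hsum : Summable (fun j : ℕ => (j:ℝ)^(-(3:ℝ)/2)) := Real.summable_nat_rpow.2 (by norm_num)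
  refine ⟨16*Real.sqrt Real.pi + (∑' j : ℕ, (j:ℝ)^(-(3:ℝ)/2)) + 2, 1, zero_le_one, ?_⟩
  intro t ht xh hxh
  have e2 : Real.exp (-(2*t)) = Real.exp (-t) ^ 2 := by rw [← Real.exp_nat_mul]; norm_num
  have e1 : Real.exp t = (Real.exp (-t))⁻¹ := by rw [Real.exp_neg, inv_inv]
  have he2 : Real.exp (-t) ≤ 1/2 := by
    have := Real.add_one_le_exp t
    rw [Real.exp_neg, one_div]
    apply inv_anti₀ (by norm_num) (by linarith)
  have e3 : Real.exp (2*t) = (Real.exp (-t) ^ 2)⁻¹ := by rw [← e2, Real.exp_neg, inv_inv]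
  rw [e2, e1, e3]
  have he := Real.exp_pos (-t)
  set e := Real.exp (-t)
  set X := (e^2)⁻¹ * xh with hXd
  have hX : 0 < X := by positivity
  have hxX : xh = e^2*X := by rw [hXd]; field_simp
  rw [hxX, scale e he X hX]
  set k := (Real.sqrt (2*Real.pi))⁻¹ with hk'
  have hk : k ≤ 1 := by
    apply inv_le_one_of_one_le₀
    rw [Real.one_le_sqrt]
    linarith [Real.pi_gt_three]
  have hk0 : 0 < k := by positivity
  have hS : e^2 * (∑ j ∈ Finset.Ico 1 ⌈X⌉₊, e⁻¹ * (1 - e) ^ (j - 1) * (j : ℝ) ^ j *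
              Real.exp (-((1 - e) * j)) / (j.factorial : ℝ)) =
      e * ∑ j ∈ Finset.Ico 1 ⌈X⌉₊, (1 - e) ^ (j - 1) * (j : ℝ) ^ j *
              Real.exp (-((1 - e) * j)) / (j.factorial : ℝ) := by
    rw [Finset.mul_sum, Finset.mul_sum]
    refine Finset.sum_congr rfl fun j _ => ?_
    field_simp
  rw [hS, ← mul_sub, abs_mul, abs_of_pos he, mul_comm e]
  gcongr
  have c2 : 0 < e^2/2 := by positivity
  have c4 : 0 < e^2/4 := by positivity
  have A : |(∑ j ∈ Finset.Ico 1 ⌈X⌉₊, (1 - e) ^ (j - 1) * (j : ℝ) ^ j *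
              Real.exp (-((1 - e) * j)) / (j.factorial : ℝ))
        - ∑ j ∈ Finset.Ico 1 ⌈X⌉₊, k * hfun (e^2/2) j| ≤
      16*Real.sqrt Real.pi + ∑' j : ℕ, (j:ℝ)^(-(3:ℝ)/2) := by
    rw [← Finset.sum_sub_distrib]
    refine (Finset.abs_sum_le_sum_abs _ _).trans ?_
    refine (Finset.sum_le_sum fun j hj => term e he he2 j (Finset.mem_Ico.1 hj).1).trans ?_
    rw [Finset.sum_add_distrib, ← Finset.mul_sum]
    apply add_le_add
    · have := si_bound (hfun_nonneg _) (hfun_anti _ c4) (hfun_int _ c4) ⌈X⌉₊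
      rw [hfun_val e he] at this
      calc _ ≤ 8*e*(2*Real.sqrt Real.pi/e) := by gcongr
        _ = _ := by field_simp; norm_num
    · exact hsum.sum_le_tsum _ fun j _ => by positivity
  have B := (si_abs (hfun_nonneg _) (hfun_anti _ c2) (hfun_int _ c2) X hX).trans (hfun_one _ c2)
  rw [← Finset.mul_sum] at A
  set P := ∑ j ∈ Finset.Ico 1 ⌈X⌉₊, hfun (e^2/2) j
  set I := ∫ y in Set.Ioc (0:ℝ) X, hfun (e^2/2) y
  have B' : |k*P - k*I| ≤ 2 := by
    rw [← mul_sub, abs_mul, abs_of_pos hk0]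
    nlinarith [abs_nonneg (P-I)]
  refine (abs_sub_le _ (k*P) _).trans ?_
  linarith
end
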